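/- The identity ∑_{k=1}^∞ H_k·h_k²/k² = (3/2)·∑_{k=1}^∞ h_k²/k³ + 2·∑_{k=1}^∞ h_k·h_k^{(2)}/k² holds, all three series being convergent. -/

import Mathlib

open Finset Real

noncomputable def H (k : ℕ) : ℝ := ∑ j ∈ Finset.range k, (1 : ℝ) / ((j : ℝ) + 1)
noncomputable def H2 (k : ℕ) : ℝ := ∑ j ∈ Finset.range k, (1 : ℝ) / ((j : ℝ) + 1) ^ 2
noncomputable def H3 (k : ℕ) : ℝ := ∑ j ∈ Finset.range k, (1 : ℝ) / ((j : ℝ) + 1) ^ 3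
noncomputable def h (k : ℕ) : ℝ := ∑ j ∈ Finset.range k, (1 : ℝ) / (2 * (j : ℝ) + 1)
noncomputable def h2 (k : ℕ) : ℝ := ∑ j ∈ Finset.range k, (1 : ℝ) / (2 * (j : ℝ) + 1) ^ 2
noncomputable def h3 (k : ℕ) : ℝ := ∑ j ∈ Finset.range k, (1 : ℝ) / (2 * (j : ℝ) + 1) ^ 3
noncomputable def zeta (s : ℕ) : ℝ := ∑' n : ℕ, (1 : ℝ) / ((n : ℝ) + 1) ^ s

open Filter Topology

/-- Shifted odd harmonic sums `∑_{j<k} 1/(2j+1+β)^s`. -/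
noncomputable def oddSum (s : ℕ) (β : ℝ) (k : ℕ) : ℝ :=
  ∑ j ∈ Finset.range k, 1 / (2 * (j : ℝ) + 1 + β) ^ s

/-- The kernel `1/(k+1) - 1/(k+1+β)`. -/
noncomputable def kernel (β : ℝ) (k : ℕ) : ℝ := 1 / ((k : ℝ) + 1) - 1 / ((k : ℝ) + 1 + β)

/-- The kernel transform `∑_{k≥1} (1/k - 1/(k+β)) q_β(k)`. -/
noncomputable def kernelSum (q : ℝ → ℕ → ℝ) (β : ℝ) : ℝ := ∑' k : ℕ, kernel β k * q β (k + 1)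

/-- A common majorant for cubic polynomials in the odd harmonic sums. -/
noncomputable def majorant (k : ℕ) : ℝ := (1 + h k) ^ 3

lemma h_nonneg (k : ℕ) : 0 ≤ h k := Finset.sum_nonneg fun j _ => by positivity

lemma H_nonneg (k : ℕ) : 0 ≤ H k := Finset.sum_nonneg fun j _ => by positivity

lemma h2_nonneg (k : ℕ) : 0 ≤ h2 k := Finset.sum_nonneg fun j _ => by positivity

lemma h3_nonneg (k : ℕ) : 0 ≤ h3 k := Finset.sum_nonneg fun j _ => by positivity

lemma oddSum_nonneg (s : ℕ) {β : ℝ} (hβ : 0 ≤ β) (k : ℕ) : 0 ≤ oddSum s β k :=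
  Finset.sum_nonneg fun j _ => by positivity

lemma oddSum_one_zero (k : ℕ) : oddSum 1 0 k = h k := by simp [oddSum, h]

lemma oddSum_two_zero (k : ℕ) : oddSum 2 0 k = h2 k := by simp [oddSum, h2]

lemma oddSum_three_zero (k : ℕ) : oddSum 3 0 k = h3 k := by simp [oddSum, h3]

lemma oddSum_le_h {s : ℕ} (hs : 1 ≤ s) {β : ℝ} (hβ : 0 ≤ β) (k : ℕ) : oddSum s β k ≤ h k := by
  refine Finset.sum_le_sum fun j _ => ?_
  have hj : (0 : ℝ) ≤ j := j.cast_nonneg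
  refine one_div_le_one_div_of_le (by positivity) ?_
  calc 2 * (j : ℝ) + 1 ≤ 2 * (j : ℝ) + 1 + β := by linarith
    _ ≤ _ := le_self_pow₀ (by linarith) (by omega)

lemma oddSum_succ (s : ℕ) (β : ℝ) (k : ℕ) :
    oddSum s β (k + 1) = oddSum s β k + 1 / (2 * (k : ℝ) + 1 + β) ^ s := by
  simp [oddSum, Finset.sum_range_succ]

lemma oddSum_shift (s : ℕ) (β : ℝ) (k : ℕ) :
    oddSum s β (k + 1) = oddSum s (β + 2) k + 1 / (1 + β) ^ s := by
  simp only [oddSum, Finset.sum_range_succ']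
  congr 1
  · refine Finset.sum_congr rfl fun j _ => ?_
    push_cast
    congr 2
    ring
  · simp

lemma h_le_H (k : ℕ) : h k ≤ H k :=
  Finset.sum_le_sum fun j _ => one_div_le_one_div_of_le (by positivity)
    (by linarith [(Nat.cast_nonneg j : (0 : ℝ) ≤ j)])

lemma H_le_two_h (k : ℕ) : H k ≤ 2 * h k := by
  rw [H, h, Finset.mul_sum]
  refine Finset.sum_le_sum fun j _ => ?_
  rw [mul_one_div, div_le_div_iff₀ (by positivity) (by positivity)]
  linarith

lemma H_le_log (k : ℕ) : H k ≤ 1 + Real.log k := by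
  have := harmonic_le_one_add_log k
  simpa [harmonic, H] using this

lemma majorant_nonneg (k : ℕ) : 0 ≤ majorant k := by
  have := h_nonneg k
  unfold majorant
  positivity

lemma majorant_le_rpow (k : ℕ) : majorant (k + 1) ≤ 1000 * ((k : ℝ) + 1) ^ (3 / 8 : ℝ) := by
  have h1 : (1 : ℝ) ≤ (k : ℝ) + 1 := by linarith [(Nat.cast_nonneg k : (0 : ℝ) ≤ k)]
  have hlog := Real.log_le_rpow_div (x := (k : ℝ) + 1) (by positivity) (ε := 1 / 8) (by norm_num)
  have hone : (1 : ℝ) ≤ ((k : ℝ) + 1) ^ (1 / 8 : ℝ) := Real.one_le_rpow h1 (by norm_num)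
  have hh : 1 + h (k + 1) ≤ 10 * ((k : ℝ) + 1) ^ (1 / 8 : ℝ) := by
    have := (h_le_H (k + 1)).trans (H_le_log (k + 1))
    push_cast at this
    linarith
  have h0 := h_nonneg (k + 1)
  calc majorant (k + 1) ≤ (10 * ((k : ℝ) + 1) ^ (1 / 8 : ℝ)) ^ 3 := by
        unfold majorant
        gcongr
    _ = 1000 * ((k : ℝ) + 1) ^ (3 / 8 : ℝ) := by
        rw [mul_pow, ← Real.rpow_natCast (((k : ℝ) + 1) ^ (1 / 8 : ℝ)),
          ← Real.rpow_mul (by positivity)]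
        norm_num

lemma summable_majorant : Summable fun k : ℕ => majorant (k + 1) / ((k : ℝ) + 1) ^ 2 := by
  have hs : Summable fun k : ℕ => 1000 * ((k : ℝ) + 1) ^ (-(13 / 8) : ℝ) := by
    refine Summable.mul_left _ ?_
    have := (summable_nat_add_iff 1).2 (Real.summable_nat_rpow (p := -(13 / 8)).2 (by norm_num))
    simpa using this
  refine Summable.of_nonneg_of_le
    (fun k => div_nonneg (majorant_nonneg _) (by positivity)) (fun k => ?_) hs
  have hk : (0 : ℝ) < (k : ℝ) + 1 := by positivity
  rw [div_le_iff₀ (by positivity), mul_assoc, ← Real.rpow_natCast, ← Real.rpow_add hk]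
  refine (majorant_le_rpow k).trans_eq ?_
  norm_num

lemma tendsto_majorant_div :
    Tendsto (fun k : ℕ => majorant (k + 1) / ((k : ℝ) + 1)) atTop (𝓝 0) := by
  have ht : Tendsto (fun k : ℕ => 1000 * ((k : ℝ) + 1) ^ (-(5 / 8) : ℝ)) atTop (𝓝 0) := by
    have := ((tendsto_rpow_neg_atTop (y := 5 / 8) (by norm_num)).comp
      (tendsto_natCast_atTop_atTop.atTop_add (tendsto_const_nhds (x := (1 : ℝ))))).const_mul 1000
    simpa using this
  refine squeeze_zero (fun k => div_nonneg (majorant_nonneg _) (by positivity)) (fun k => ?_) ht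
  have hk : (0 : ℝ) < (k : ℝ) + 1 := by positivity
  rw [div_le_iff₀ hk, mul_assoc]
  nth_rewrite 2 [← Real.rpow_one ((k : ℝ) + 1)]
  rw [← Real.rpow_add hk]
  refine (majorant_le_rpow k).trans_eq ?_
  norm_num

lemma kernel_eq {β : ℝ} (hβ : 0 ≤ β) (k : ℕ) :
    kernel β k = β / (((k : ℝ) + 1) * ((k : ℝ) + 1 + β)) := by
  unfold kernel
  field_simp
  ring

lemma kernel_nonneg {β : ℝ} (hβ : 0 ≤ β) (k : ℕ) : 0 ≤ kernel β k := by
  rw [kernel_eq hβ]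
  positivity

lemma kernel_le {β : ℝ} (hβ : 0 ≤ β) (k : ℕ) : kernel β k ≤ β / ((k : ℝ) + 1) ^ 2 := by
  have hk : (0 : ℝ) < (k : ℝ) + 1 := by positivity
  rw [kernel_eq hβ, sq]
  exact div_le_div_of_nonneg_left hβ (by positivity)
    (mul_le_mul_of_nonneg_left (by linarith) hk.le)

lemma summable_kernel_mul {q : ℕ → ℝ} {C : ℝ} (hq : ∀ k, |q k| ≤ C * majorant k) {β : ℝ}
    (hβ : 0 ≤ β) : Summable fun k : ℕ => kernel β k * q (k + 1) := by
  refine Summable.of_norm_bounded (summable_majorant.mul_left (β * C)) fun k => ?_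
  rw [Real.norm_eq_abs, abs_mul, abs_of_nonneg (kernel_nonneg hβ k)]
  calc kernel β k * |q (k + 1)| ≤ β / ((k : ℝ) + 1) ^ 2 * (C * majorant (k + 1)) :=
        mul_le_mul (kernel_le hβ k) (hq _) (abs_nonneg _) (by positivity)
    _ = _ := by ring

/-- The telescoping relation between consecutive coefficients of the kernel transform of
`∏ (c_j + ξ) / (c_j - ξ)`, `c_j = 2 j - 1 + β`, under the shift `β ↦ β + 2`. -/
lemma kernelSum_shift {p q : ℝ → ℕ → ℝ} {C : ℝ}
    (hp : ∀ β, 0 ≤ β → ∀ k, |p β k| ≤ C * majorant k)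
    (hq : ∀ β, 0 ≤ β → ∀ k, |q β k| ≤ C * majorant k)
    (hrec : ∀ β, 0 ≤ β → ∀ k : ℕ,
      (2 * (k : ℝ) + 1 + β) * (q β (k + 1) - q β k) = p β (k + 1) + p β k)
    (hshift : ∀ β, 0 ≤ β → ∀ k : ℕ,
      (1 + β) * q β (k + 1) - p β (k + 1) = (1 + β) * q (β + 2) k + p (β + 2) k)
    {β : ℝ} (hβ : 0 ≤ β) :
    (1 + β) * (kernelSum q (β + 2) - kernelSum q β) + (kernelSum p (β + 2) - kernelSum p β)
      = (1 + (1 + β) / (2 + β)) * q β 1 + (1 / (1 + β) - 1 / (2 + β)) * p β 1 := by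
  have hβ2 : 0 ≤ β + 2 := by linarith
  set W : ℕ → ℝ := fun k =>
    (1 + β) * q β (k + 1) * (1 / ((k : ℝ) + 1 + β) + 1 / ((k : ℝ) + 2 + β))
      + p β (k + 1) * (1 / ((k : ℝ) + 1 + β) - 1 / ((k : ℝ) + 2 + β)) with hW
  have sum1 := (summable_kernel_mul (hq _ hβ2) hβ2).hasSum
  have sum2 := (summable_kernel_mul (hq _ hβ) hβ).hasSum
  have sum3 := (summable_kernel_mul (hp _ hβ2) hβ2).hasSum
  have sum4 := (summable_kernel_mul (hp _ hβ) hβ).hasSum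
  have hsum := ((sum1.sub sum2).mul_left (1 + β)).add (sum3.sub sum4)
  have hterm : ∀ k : ℕ, (1 + β) * (kernel (β + 2) k * q (β + 2) (k + 1) - kernel β k * q β (k + 1))
      + (kernel (β + 2) k * p (β + 2) (k + 1) - kernel β k * p β (k + 1)) = W k - W (k + 1) := by
    intro k
    have e1 := hrec β hβ (k + 1)
    have e2 := hshift β hβ (k + 1)
    have e3 : p β (k + 1 + 1) =
      (2 * ((k : ℝ) + 1) + 1 + β) * (q β (k + 1 + 1) - q β (k + 1)) - p β (k + 1) := by
      push_cast at e1
      linarith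
    have e4 : (1 + β) * q (β + 2) (k + 1) + p (β + 2) (k + 1)
        = (1 + β) * q β (k + 1 + 1) - p β (k + 1 + 1) := e2.symm
    calc _ = kernel (β + 2) k * ((1 + β) * q (β + 2) (k + 1) + p (β + 2) (k + 1))
          - kernel β k * ((1 + β) * q β (k + 1) + p β (k + 1)) := by ring
      _ = _ := by
        rw [e4, hW]
        simp only [e3, kernel]
        push_cast
        field_simp
        ring
  have hlim : Tendsto W atTop (𝓝 0) := by
    have hb : Tendsto (fun k : ℕ => (1 + β) * (C * (majorant (k + 1) / ((k : ℝ) + 1))) * 2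
        + C * (majorant (k + 1) / ((k : ℝ) + 1))) atTop (𝓝 0) := by
      have := ((tendsto_majorant_div.const_mul C).const_mul (1 + β)).mul_const 2
      simpa using this.add (tendsto_majorant_div.const_mul C)
    refine squeeze_zero_norm (fun k => ?_) hb
    have hk : (0 : ℝ) < (k : ℝ) + 1 := by positivity
    have i1 : 1 / ((k : ℝ) + 1 + β) ≤ 1 / ((k : ℝ) + 1) :=
      one_div_le_one_div_of_le hk (by linarith)
    have i2 : 1 / ((k : ℝ) + 2 + β) ≤ 1 / ((k : ℝ) + 1) :=
      one_div_le_one_div_of_le hk (by linarith)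
    have j1 : 0 ≤ 1 / ((k : ℝ) + 1 + β) := by positivity
    have j2 : 0 ≤ 1 / ((k : ℝ) + 2 + β) := by positivity
    have a1 : |1 / ((k : ℝ) + 1 + β) + 1 / ((k : ℝ) + 2 + β)| ≤ 2 * (1 / ((k : ℝ) + 1)) := by
      rw [abs_of_nonneg (by positivity)]
      linarith
    have a2 : |1 / ((k : ℝ) + 1 + β) - 1 / ((k : ℝ) + 2 + β)| ≤ 1 / ((k : ℝ) + 1) := by
      rw [abs_le]
      constructor <;> linarith
    rw [Real.norm_eq_abs]
    refine (abs_add_le _ _).trans ?_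
    rw [abs_mul, abs_mul, abs_mul, abs_of_nonneg (by positivity : 0 ≤ 1 + β)]
    have hC : 0 ≤ C * majorant (k + 1) := (abs_nonneg _).trans (hq β hβ (k + 1))
    calc _ ≤ (1 + β) * (C * majorant (k + 1)) * (2 * (1 / ((k : ℝ) + 1)))
          + C * majorant (k + 1) * (1 / ((k : ℝ) + 1)) := by
          gcongr
          · exact hq β hβ _
          · exact hp β hβ _
      _ = _ := by ring
  have htel : Tendsto (fun n => ∑ k ∈ Finset.range n, (W k - W (k + 1))) atTop (𝓝 (W 0)) := by
    simp only [Finset.sum_range_sub']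
    simpa using hlim.const_sub (W 0)
  simp only [hterm] at hsum
  have := tendsto_nhds_unique hsum.tendsto_sum_nat htel
  simp only [kernelSum]
  rw [this, hW]
  simp only [Nat.cast_zero, zero_add]
  field_simp

/-- Linear coefficient of `∏_{j≤k} (c_j + ξ) / (c_j - ξ)` in `ξ`, where `c_j = 2 j - 1 + β`. -/
noncomputable def coeffOne (β : ℝ) (k : ℕ) : ℝ := 2 * oddSum 1 β k

/-- Quadratic coefficient of `∏_{j≤k} (c_j + ξ) / (c_j - ξ)`. -/
noncomputable def coeffTwo (β : ℝ) (k : ℕ) : ℝ := 2 * oddSum 1 β k ^ 2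

/-- Cubic coefficient of `∏_{j≤k} (c_j + ξ) / (c_j - ξ)`. -/
noncomputable def coeffThree (β : ℝ) (k : ℕ) : ℝ :=
  (4 * oddSum 1 β k ^ 3 + 2 * oddSum 3 β k) / 3

lemma coeffTwo_nonneg (β : ℝ) (k : ℕ) : 0 ≤ coeffTwo β k := by
  unfold coeffTwo
  positivity

lemma coeffThree_nonneg {β : ℝ} (hβ : 0 ≤ β) (k : ℕ) : 0 ≤ coeffThree β k := by
  have h1 := oddSum_nonneg 1 hβ k
  have h3 := oddSum_nonneg 3 hβ k
  unfold coeffThree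
  positivity

lemma cubic_le_majorant {x : ℝ} {k : ℕ} (hx : 0 ≤ x) (hxk : x ≤ h k) :
    1 + 3 * x + 3 * x ^ 2 + x ^ 3 ≤ majorant k := by
  calc 1 + 3 * x + 3 * x ^ 2 + x ^ 3 = (1 + x) ^ 3 := by ring
    _ ≤ _ := by unfold majorant; gcongr

lemma abs_one_le_majorant (k : ℕ) : |(1 : ℝ)| ≤ 4 * majorant k := by
  have := cubic_le_majorant le_rfl (h_nonneg k)
  rw [abs_one]
  linarith

lemma abs_coeffOne_le (β : ℝ) (hβ : 0 ≤ β) (k : ℕ) : |coeffOne β k| ≤ 4 * majorant k := by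
  have h0 := oddSum_nonneg 1 hβ k
  have h1 := cubic_le_majorant h0 (oddSum_le_h le_rfl hβ k)
  rw [coeffOne, abs_of_nonneg (by positivity)]
  nlinarith [pow_nonneg h0 2, pow_nonneg h0 3]

lemma abs_coeffTwo_le (β : ℝ) (hβ : 0 ≤ β) (k : ℕ) : |coeffTwo β k| ≤ 4 * majorant k := by
  have h0 := oddSum_nonneg 1 hβ k
  have h1 := cubic_le_majorant h0 (oddSum_le_h le_rfl hβ k)
  rw [abs_of_nonneg (coeffTwo_nonneg β k), coeffTwo]
  nlinarith [pow_nonneg h0 2, pow_nonneg h0 3]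

lemma abs_coeffThree_le (β : ℝ) (hβ : 0 ≤ β) (k : ℕ) : |coeffThree β k| ≤ 4 * majorant k := by
  have h0 := oddSum_nonneg 1 hβ k
  have h1 := oddSum_le_h le_rfl hβ k
  have h2 := oddSum_le_h (s := 3) (by norm_num) hβ k
  have h3 := cubic_le_majorant (h_nonneg k) (le_refl (h k))
  have h4 : oddSum 1 β k ^ 3 ≤ h k ^ 3 := by gcongr
  have h5 := h_nonneg k
  rw [abs_of_nonneg (coeffThree_nonneg hβ k), coeffThree]
  nlinarith [pow_nonneg h5 2, pow_nonneg h5 3]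

lemma kernelSum_one_shift {β : ℝ} (hβ : 0 ≤ β) :
    kernelSum (fun _ _ => 1) (β + 2) - kernelSum (fun _ _ => 1) β
      = 1 / (1 + β) + 1 / (2 + β) := by
  have key := kernelSum_shift (p := fun _ _ => 0) (q := fun _ _ => 1) (C := 4)
    (fun _ _ k => by simpa using majorant_nonneg k)
    (fun _ _ k => abs_one_le_majorant k) (by simp) (by simp) hβ
  have hz : ∀ γ, kernelSum (fun _ _ => 0) γ = 0 := by simp [kernelSum]
  rw [hz, hz] at key
  have hc : 1 + β ≠ 0 := by positivity
  refine mul_left_cancel₀ hc ?_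
  rw [sub_zero, add_zero] at key
  rw [key]
  field_simp
  ring

lemma kernelSum_coeffOne_shift {β : ℝ} (hβ : 0 ≤ β) :
    kernelSum coeffOne (β + 2) - kernelSum coeffOne β = 2 / (1 + β) ^ 2 := by
  have key := kernelSum_shift (p := fun _ _ => 1) (q := coeffOne) (C := 4)
    (fun _ _ k => abs_one_le_majorant k) abs_coeffOne_le
    (fun β hβ k => by
      simp only [coeffOne, oddSum_succ]
      field_simp
      ring)
    (fun β hβ k => by
      simp only [coeffOne, oddSum_shift]
      field_simp
      ring) hβ
  rw [kernelSum_one_shift hβ] at key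
  have hc : 1 + β ≠ 0 := by positivity
  refine mul_left_cancel₀ hc ?_
  rw [← eq_sub_iff_add_eq] at key
  rw [key]
  simp only [coeffOne, oddSum, Finset.sum_range_one, Nat.cast_zero]
  field_simp
  ring

lemma kernelSum_coeffTwo_shift {β : ℝ} (hβ : 0 ≤ β) :
    kernelSum coeffTwo (β + 2) - kernelSum coeffTwo β = 2 / (1 + β) ^ 3 := by
  have key := kernelSum_shift (p := coeffOne) (q := coeffTwo) (C := 4)
    abs_coeffOne_le abs_coeffTwo_le
    (fun β hβ k => by
      simp only [coeffOne, coeffTwo, oddSum_succ]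
      field_simp
      ring)
    (fun β hβ k => by
      simp only [coeffOne, coeffTwo, oddSum_shift]
      field_simp
      ring) hβ
  rw [kernelSum_coeffOne_shift hβ] at key
  have hc : 1 + β ≠ 0 := by positivity
  refine mul_left_cancel₀ hc ?_
  rw [← eq_sub_iff_add_eq] at key
  rw [key]
  simp only [coeffOne, coeffTwo, oddSum, Finset.sum_range_one, Nat.cast_zero]
  field_simp
  ring

lemma kernelSum_coeffThree_shift {β : ℝ} (hβ : 0 ≤ β) :
    kernelSum coeffThree (β + 2) - kernelSum coeffThree β = 2 / (1 + β) ^ 4 := by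
  have key := kernelSum_shift (p := coeffTwo) (q := coeffThree) (C := 4)
    abs_coeffTwo_le abs_coeffThree_le
    (fun β hβ k => by
      simp only [coeffThree, coeffTwo, oddSum_succ]
      field_simp
      ring)
    (fun β hβ k => by
      simp only [coeffThree, coeffTwo, oddSum_shift]
      field_simp
      ring) hβ
  rw [kernelSum_coeffTwo_shift hβ] at key
  have hc : 1 + β ≠ 0 := by positivity
  refine mul_left_cancel₀ hc ?_
  rw [← eq_sub_iff_add_eq] at key
  rw [key]
  simp only [coeffThree, coeffTwo, oddSum, Finset.sum_range_one, Nat.cast_zero]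
  field_simp
  ring

lemma kernelSum_zero (q : ℝ → ℕ → ℝ) : kernelSum q 0 = 0 := by simp [kernelSum, kernel]

lemma kernelSum_telescope {q : ℝ → ℕ → ℝ} {δ : ℝ → ℝ}
    (hq : ∀ β, 0 ≤ β → kernelSum q (β + 2) - kernelSum q β = δ β) {β : ℝ} (hβ : 0 ≤ β) (N : ℕ) :
    kernelSum q (β + 2 * N) - kernelSum q β = ∑ j ∈ Finset.range N, δ (β + 2 * j) := by
  induction N with
  | zero => simp
  | succ n ih =>
    rw [Finset.sum_range_succ, ← ih, ← hq (β + 2 * n) (by positivity)]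
    push_cast
    ring_nf

lemma kernelSum_one_even (n : ℕ) : kernelSum (fun _ _ => 1) (2 * n) = h n + H n / 2 := by
  have := kernelSum_telescope (fun β hβ => kernelSum_one_shift hβ) le_rfl n
  rw [kernelSum_zero, sub_zero, zero_add] at this
  rw [this, h, H, Finset.sum_div, ← Finset.sum_add_distrib]
  refine Finset.sum_congr rfl fun j _ => ?_
  field_simp
  ring

lemma kernelSum_coeffOne_even (n : ℕ) : kernelSum coeffOne (2 * n) = 2 * h2 n := by
  have := kernelSum_telescope (fun β hβ => kernelSum_coeffOne_shift hβ) le_rfl n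
  rw [kernelSum_zero, sub_zero, zero_add] at this
  rw [this, h2, Finset.mul_sum]
  exact Finset.sum_congr rfl fun j _ => by ring_nf

lemma kernelSum_coeffTwo_even (n : ℕ) : kernelSum coeffTwo (2 * n) = 2 * h3 n := by
  have := kernelSum_telescope (fun β hβ => kernelSum_coeffTwo_shift hβ) le_rfl n
  rw [kernelSum_zero, sub_zero, zero_add] at this
  rw [this, h3, Finset.mul_sum]
  exact Finset.sum_congr rfl fun j _ => by ring_nf

lemma oddSum_one_antitone {γ β : ℝ} (hγ : 0 ≤ γ) (hβ : 0 ≤ β) (k : ℕ) :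
    oddSum 1 (γ + β) k ≤ oddSum 1 γ k :=
  Finset.sum_le_sum fun j _ => one_div_le_one_div_of_le (by positivity)
    (by gcongr; linarith)

lemma mul_oddSum_one_sub_le {γ β : ℝ} (hγ : 0 ≤ γ) (hβ : 0 ≤ β) (hβ1 : β ≤ 1) (k : ℕ) :
    γ * (oddSum 1 γ k - oddSum 1 (γ + β) k) ≤ h k := by
  rw [oddSum, oddSum, h, ← Finset.sum_sub_distrib, Finset.mul_sum]
  refine Finset.sum_le_sum fun j _ => ?_
  have hj : (0 : ℝ) ≤ j := j.cast_nonneg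
  have : γ * (1 / (2 * (j : ℝ) + 1 + γ) ^ 1 - 1 / (2 * (j : ℝ) + 1 + (γ + β)) ^ 1)
      = γ * β / ((2 * (j : ℝ) + 1 + γ) * (2 * (j : ℝ) + 1 + (γ + β))) := by
    field_simp
    ring
  rw [this, div_le_div_iff₀ (by positivity) (by positivity)]
  have h1 : γ * β ≤ γ * 1 := by gcongr
  have h2 : γ * β * (2 * (j : ℝ) + 1) ≤ γ * 1 * (2 * (j : ℝ) + 1) := by gcongr
  have h3 : (2 * (j : ℝ) + 1) * γ ≤ (2 * (j : ℝ) + 1 + γ) * (2 * (j : ℝ) + 1 + (γ + β)) :=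
    mul_le_mul (by linarith) (by linarith) hγ (by positivity)
  linarith

lemma oddSum_three_sub_le {γ β : ℝ} (hγ : 0 ≤ γ) (hβ : 0 ≤ β) (k : ℕ) :
    oddSum 3 γ k - oddSum 3 (γ + β) k ≤ 3 * (oddSum 1 γ k - oddSum 1 (γ + β) k) := by
  simp only [oddSum]
  rw [← Finset.sum_sub_distrib, ← Finset.sum_sub_distrib, Finset.mul_sum]
  refine Finset.sum_le_sum fun j _ => ?_
  have hj : (0 : ℝ) ≤ j := j.cast_nonneg
  set u := 1 / (2 * (j : ℝ) + 1 + γ) with hu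
  set v := 1 / (2 * (j : ℝ) + 1 + (γ + β)) with hv
  have v0 : 0 ≤ v := by positivity
  have vu : v ≤ u := one_div_le_one_div_of_le (by positivity) (by linarith)
  have u1 : u ≤ 1 := (div_le_one (by positivity)).2 (by linarith)
  have : u ^ 3 - v ^ 3 ≤ 3 * (u - v) := by
    have : u ^ 2 + u * v + v ^ 2 ≤ 3 := by nlinarith
    nlinarith
  simpa [hu, hv] using this

lemma oddSum_three_antitone {γ β : ℝ} (hγ : 0 ≤ γ) (hβ : 0 ≤ β) (k : ℕ) :
    oddSum 3 (γ + β) k ≤ oddSum 3 γ k :=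
  Finset.sum_le_sum fun j _ => one_div_le_one_div_of_le (by positivity)
    (by gcongr; linarith)

/-- If `q` is antitone in `β` at a controlled rate, its kernel transform is flat at infinity. -/
lemma tendsto_kernelSum_sub {q : ℝ → ℕ → ℝ} {C β : ℝ}
    (hq0 : ∀ γ, 0 ≤ γ → ∀ k, 0 ≤ q γ k)
    (hq : ∀ γ, 0 ≤ γ → ∀ k, |q γ k| ≤ C * majorant k)
    (hanti : ∀ γ, 0 ≤ γ → ∀ k, q (γ + β) k ≤ q γ k)
    (hrate : ∀ γ, 0 ≤ γ → ∀ k, γ * (q γ k - q (γ + β) k) ≤ C * majorant k)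
    (hβ : 0 ≤ β) (hβ1 : β ≤ 1) :
    Tendsto (fun N : ℕ => kernelSum q (β + 2 * N) - kernelSum q (2 * N)) atTop (𝓝 0) := by
  have hbound : ∀ (N k : ℕ), ‖kernel (β + 2 * N) k * q (β + 2 * N) (k + 1)
      - kernel (2 * N) k * q (2 * N) (k + 1)‖
      ≤ C * majorant (k + 1) / (((k : ℝ) + 1) * ((k : ℝ) + 1 + 2 * N)) := by
    intro N k
    set γ : ℝ := 2 * N with hγdef
    have hγ : 0 ≤ γ := by positivity
    have hk : (0 : ℝ) < (k : ℝ) + 1 := by positivity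
    have hC := (abs_nonneg _).trans (hq γ hγ (k + 1))
    have hle := (le_abs_self _).trans (hq (γ + β) (by positivity) (k + 1))
    have hnn := hq0 (γ + β) (by positivity) (k + 1)
    have e : kernel (β + γ) k * q (β + γ) (k + 1) - kernel γ k * q γ (k + 1)
        = β / (((k : ℝ) + 1 + γ) * ((k : ℝ) + 1 + γ + β)) * q (γ + β) (k + 1)
          - γ * (q γ (k + 1) - q (γ + β) (k + 1)) / (((k : ℝ) + 1) * ((k : ℝ) + 1 + γ)) := by
      rw [add_comm β γ, kernel, kernel]
      field_simp
      ring
    have a1 : β / (((k : ℝ) + 1 + γ) * ((k : ℝ) + 1 + γ + β)) * q (γ + β) (k + 1)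
        ≤ C * majorant (k + 1) / (((k : ℝ) + 1) * ((k : ℝ) + 1 + γ)) := by
      rw [div_mul_eq_mul_div]
      refine div_le_div₀ hC ?_ (by positivity) ?_
      · exact (mul_le_mul hβ1 hle hnn zero_le_one).trans_eq (one_mul _)
      · exact mul_le_mul (by linarith) (by linarith) (by positivity) (by positivity)
    have a2 : γ * (q γ (k + 1) - q (γ + β) (k + 1)) / (((k : ℝ) + 1) * ((k : ℝ) + 1 + γ))
        ≤ C * majorant (k + 1) / (((k : ℝ) + 1) * ((k : ℝ) + 1 + γ)) :=
      div_le_div_of_nonneg_right (hrate γ hγ _) (by positivity)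
    have a3 : 0 ≤ β / (((k : ℝ) + 1 + γ) * ((k : ℝ) + 1 + γ + β)) * q (γ + β) (k + 1) := by
      positivity
    have a4 : 0 ≤ γ * (q γ (k + 1) - q (γ + β) (k + 1)) / (((k : ℝ) + 1) * ((k : ℝ) + 1 + γ)) :=
      div_nonneg (mul_nonneg hγ (sub_nonneg.2 (hanti γ hγ _))) (by positivity)
    rw [e, Real.norm_eq_abs, abs_le]
    constructor <;> linarith
  have hsub : ∀ N : ℕ, kernelSum q (β + 2 * N) - kernelSum q (2 * N)
      = ∑' k : ℕ, (kernel (β + 2 * N) k * q (β + 2 * N) (k + 1)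
        - kernel (2 * N) k * q (2 * N) (k + 1)) := fun N =>
    ((summable_kernel_mul (hq _ (by positivity)) (by positivity)).tsum_sub
      (summable_kernel_mul (hq _ (by positivity)) (by positivity))).symm
  simp only [hsub]
  rw [← tsum_zero (α := ℝ) (β := ℕ)]
  refine tendsto_tsum_of_dominated_convergence (summable_majorant.mul_left C) (fun k => ?_)
    (Eventually.of_forall fun N k => (hbound N k).trans ?_)
  · refine squeeze_zero_norm (fun N => hbound N k) ?_
    refine Tendsto.const_div_atTop ?_ _
    refine Tendsto.const_mul_atTop (by positivity) ?_
    exact tendsto_atTop_add_const_left _ _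
      (tendsto_natCast_atTop_atTop.const_mul_atTop (by norm_num))
  · have hC := (abs_nonneg _).trans (hq 0 le_rfl (k + 1))
    rw [← mul_div_assoc, sq]
    exact div_le_div_of_nonneg_left hC (by positivity)
      (mul_le_mul_of_nonneg_left (by linarith [(Nat.cast_nonneg N : (0 : ℝ) ≤ N)])
        (by positivity))

lemma kernelSum_hasSum {q : ℝ → ℕ → ℝ} {s : ℕ} {β : ℝ} (hβ : 0 ≤ β)
    (hq : ∀ γ, 0 ≤ γ → kernelSum q (γ + 2) - kernelSum q γ = 2 / (1 + γ) ^ s)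
    (hlim : Tendsto (fun N : ℕ => kernelSum q (β + 2 * N) - kernelSum q (2 * N)) atTop (𝓝 0)) :
    HasSum (fun j : ℕ => 2 / (2 * (j : ℝ) + 1) ^ s - 2 / (2 * (j : ℝ) + 1 + β) ^ s)
      (kernelSum q β) := by
  rw [hasSum_iff_tendsto_nat_of_nonneg]
  · have hN : ∀ N : ℕ, ∑ j ∈ Finset.range N,
        (2 / (2 * (j : ℝ) + 1) ^ s - 2 / (2 * (j : ℝ) + 1 + β) ^ s)
        = kernelSum q β - (kernelSum q (β + 2 * N) - kernelSum q (2 * N)) := by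
      intro N
      have e1 := kernelSum_telescope hq hβ N
      have e2 := kernelSum_telescope hq le_rfl N
      rw [kernelSum_zero, sub_zero, zero_add] at e2
      have e3 : ∑ j ∈ Finset.range N, (2 : ℝ) / (2 * (j : ℝ) + 1) ^ s = kernelSum q (2 * N) := by
        rw [e2]
        exact Finset.sum_congr rfl fun j _ => by ring_nf
      have e4 : ∑ j ∈ Finset.range N, 2 / (2 * (j : ℝ) + 1 + β) ^ s
          = kernelSum q (β + 2 * N) - kernelSum q β := by
        rw [e1]
        exact Finset.sum_congr rfl fun j _ => by ring_nf
      rw [Finset.sum_sub_distrib, e3, e4]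
      ring
    simp only [hN]
    simpa using hlim.const_sub (kernelSum q β)
  · intro j
    rw [sub_nonneg]
    exact div_le_div_of_nonneg_left zero_le_two (by positivity)
      (pow_le_pow_left₀ (by positivity) (by linarith) _)

lemma kernelSum_coeffTwo_hasSum {β : ℝ} (hβ : 0 ≤ β) (hβ1 : β ≤ 1) :
    HasSum (fun j : ℕ => 2 / (2 * (j : ℝ) + 1) ^ 3 - 2 / (2 * (j : ℝ) + 1 + β) ^ 3)
      (kernelSum coeffTwo β) := by
  refine kernelSum_hasSum hβ (fun γ hγ => kernelSum_coeffTwo_shift hγ)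
    (tendsto_kernelSum_sub (fun γ _ => coeffTwo_nonneg γ) abs_coeffTwo_le
      (fun γ hγ k => ?_) (fun γ hγ k => ?_) hβ hβ1)
  · have := oddSum_nonneg 1 (add_nonneg hγ hβ) k
    unfold coeffTwo
    gcongr
    exact oddSum_one_antitone hγ hβ k
  · have h0 := oddSum_nonneg 1 (add_nonneg hγ hβ) k
    have h1 := oddSum_one_antitone hγ hβ k
    have h2 := mul_oddSum_one_sub_le hγ hβ hβ1 k
    have h3 := oddSum_le_h le_rfl hγ k
    have h4 := h_nonneg k
    have h5 := cubic_le_majorant h4 le_rfl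
    unfold coeffTwo
    calc γ * (2 * oddSum 1 γ k ^ 2 - 2 * oddSum 1 (γ + β) k ^ 2)
        = γ * (oddSum 1 γ k - oddSum 1 (γ + β) k)
          * (2 * (oddSum 1 γ k + oddSum 1 (γ + β) k)) := by ring
      _ ≤ h k * (2 * (h k + h k)) := by
          gcongr
          · linarith
          · linarith
      _ ≤ 4 * majorant k := by nlinarith [pow_nonneg h4 2, pow_nonneg h4 3]

lemma kernelSum_coeffThree_hasSum {β : ℝ} (hβ : 0 ≤ β) (hβ1 : β ≤ 1) :
    HasSum (fun j : ℕ => 2 / (2 * (j : ℝ) + 1) ^ 4 - 2 / (2 * (j : ℝ) + 1 + β) ^ 4)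
      (kernelSum coeffThree β) := by
  refine kernelSum_hasSum hβ (fun γ hγ => kernelSum_coeffThree_shift hγ)
    (tendsto_kernelSum_sub (fun γ hγ => coeffThree_nonneg hγ) abs_coeffThree_le
      (fun γ hγ k => ?_) (fun γ hγ k => ?_) hβ hβ1)
  · have := oddSum_nonneg 1 (add_nonneg hγ hβ) k
    unfold coeffThree
    gcongr
    · exact oddSum_one_antitone hγ hβ k
    · exact oddSum_three_antitone hγ hβ k
  · have h0 := oddSum_nonneg 1 (add_nonneg hγ hβ) k
    have h1 := oddSum_one_antitone hγ hβ k
    have h2 := mul_oddSum_one_sub_le hγ hβ hβ1 k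
    have h3 := oddSum_le_h le_rfl hγ k
    have h4 := h_nonneg k
    have h5 := cubic_le_majorant h4 le_rfl
    have h6 := mul_le_mul_of_nonneg_left (oddSum_three_sub_le hγ hβ k) hγ
    have h7 : γ * (oddSum 1 γ k ^ 3 - oddSum 1 (γ + β) k ^ 3) ≤ 3 * h k ^ 3 := by
      calc γ * (oddSum 1 γ k ^ 3 - oddSum 1 (γ + β) k ^ 3)
          = γ * (oddSum 1 γ k - oddSum 1 (γ + β) k) * (oddSum 1 γ k ^ 2
            + oddSum 1 γ k * oddSum 1 (γ + β) k + oddSum 1 (γ + β) k ^ 2) := by ring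
        _ ≤ h k * (h k ^ 2 + h k * h k + h k ^ 2) := by
            have := h1.trans h3
            have := h0.trans h1
            gcongr
        _ = 3 * h k ^ 3 := by ring
    unfold coeffThree
    nlinarith [pow_nonneg h4 2, pow_nonneg h4 3]

lemma tendsto_oddSum (s k : ℕ) :
    Tendsto (fun β => oddSum s β k) (𝓝[>] 0) (𝓝 (oddSum s 0 k)) := by
  refine Tendsto.mono_left ?_ nhdsWithin_le_nhds
  refine tendsto_finsetSum _ fun j _ => ?_
  have : ContinuousAt (fun β : ℝ => 1 / (2 * (j : ℝ) + 1 + β) ^ s) 0 :=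
    continuousAt_const.div (by fun_prop) (by positivity)
  exact this

lemma summable_div_of_le_majorant {q : ℕ → ℝ} {C : ℝ} (hq : ∀ k, |q k| ≤ C * majorant k)
    {β : ℝ} (hβ : 0 ≤ β) :
    Summable fun k : ℕ => q (k + 1) / (((k : ℝ) + 1) * ((k : ℝ) + 1 + β)) := by
  refine Summable.of_norm_bounded (summable_majorant.mul_left C) fun k => ?_
  rw [Real.norm_eq_abs, abs_div, abs_of_pos (a := ((k : ℝ) + 1) * _) (by positivity),
    ← mul_div_assoc, sq]
  exact div_le_div₀ ((abs_nonneg _).trans (hq _)) (hq _) (by positivity)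
    (mul_le_mul_of_nonneg_left (by linarith) (by positivity))

lemma tendsto_tsum_div_of_le_majorant {q : ℝ → ℕ → ℝ} {q₀ : ℕ → ℝ} {C : ℝ}
    (hq : ∀ β, 0 ≤ β → ∀ k, |q β k| ≤ C * majorant k)
    (hlim : ∀ k, Tendsto (fun β => q β k) (𝓝[>] 0) (𝓝 (q₀ k))) :
    Tendsto (fun β : ℝ => ∑' k : ℕ, q β (k + 1) / (((k : ℝ) + 1) * ((k : ℝ) + 1 + β))) (𝓝[>] 0)
      (𝓝 (∑' k : ℕ, q₀ (k + 1) / ((k : ℝ) + 1) ^ 2)) := by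
  refine tendsto_tsum_of_dominated_convergence (summable_majorant.mul_left C) (fun k => ?_) ?_
  · refine (hlim _).div ?_ (by positivity)
    refine Tendsto.mono_left ?_ nhdsWithin_le_nhds
    have : ContinuousAt (fun β : ℝ => ((k : ℝ) + 1) * ((k : ℝ) + 1 + β)) 0 := by fun_prop
    simpa [ContinuousAt, sq] using this
  · filter_upwards [self_mem_nhdsWithin] with β hβ k
    have hβ' : (0 : ℝ) ≤ β := le_of_lt hβ
    rw [Real.norm_eq_abs, abs_div, abs_of_pos (a := ((k : ℝ) + 1) * _) (by positivity),
      ← mul_div_assoc, sq]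
    exact div_le_div₀ ((abs_nonneg _).trans (hq _ hβ' _)) (hq _ hβ' _) (by positivity)
      (mul_le_mul_of_nonneg_left (by linarith) (by positivity))

lemma eventually_mem_unit : ∀ᶠ β : ℝ in 𝓝[>] 0, 0 < β ∧ β ≤ 1 := by
  filter_upwards [Ioc_mem_nhdsGT (zero_lt_one (α := ℝ))] with β hβ using hβ

lemma summable_odd_sq : Summable fun j : ℕ => 1 / (2 * (j : ℝ) + 1) ^ 2 := by
  have h1 := (summable_nat_add_iff 1).2 (Real.summable_one_div_nat_pow (p := 2).2 (by norm_num))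
  refine Summable.of_nonneg_of_le (fun j => by positivity) (fun j => ?_) h1
  push_cast
  gcongr
  linarith [(Nat.cast_nonneg j : (0 : ℝ) ≤ j)]

lemma tendsto_tsum_odd {r : ℝ → ℝ → ℝ} {C : ℝ}
    (hr : ∀ a β, 1 ≤ a → 0 < β → β ≤ 1 → |r a β| ≤ C * (1 / a ^ 2))
    (hlim : ∀ a, 1 ≤ a → ContinuousAt (r a) 0) :
    Tendsto (fun β : ℝ => ∑' j : ℕ, r (2 * (j : ℝ) + 1) β) (𝓝[>] 0)
      (𝓝 (∑' j : ℕ, r (2 * (j : ℝ) + 1) 0)) := by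
  have ha : ∀ j : ℕ, (1 : ℝ) ≤ 2 * (j : ℝ) + 1 := fun j => by
    linarith [(Nat.cast_nonneg j : (0 : ℝ) ≤ j)]
  refine tendsto_tsum_of_dominated_convergence (summable_odd_sq.mul_left C)
    (fun j => (hlim _ (ha j)).tendsto.mono_left nhdsWithin_le_nhds) ?_
  filter_upwards [eventually_mem_unit] with β hβ j
  exact hr _ _ (ha j) hβ.1 hβ.2

lemma tendsto_coeffThree (k : ℕ) :
    Tendsto (fun β => coeffThree β k) (𝓝[>] 0) (𝓝 ((4 * h k ^ 3 + 2 * h3 k) / 3)) := by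
  have h1 := tendsto_oddSum 1 k
  have h3 := tendsto_oddSum 3 k
  rw [oddSum_one_zero] at h1
  rw [oddSum_three_zero] at h3
  exact (((h1.pow 3).const_mul 4).add (h3.const_mul 2)).div_const 3

lemma tendsto_coeffTwo (k : ℕ) :
    Tendsto (fun β => coeffTwo β k) (𝓝[>] 0) (𝓝 (2 * h k ^ 2)) := by
  have h1 := tendsto_oddSum 1 k
  rw [oddSum_one_zero] at h1
  exact (h1.pow 2).const_mul 2

lemma kernelSum_div {q : ℝ → ℕ → ℝ} {β : ℝ} (hβ : 0 < β) :
    ∑' k : ℕ, q β (k + 1) / (((k : ℝ) + 1) * ((k : ℝ) + 1 + β)) = kernelSum q β / β := by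
  rw [kernelSum, ← tsum_div_const]
  refine tsum_congr fun k => ?_
  rw [kernel_eq hβ.le]
  field_simp

lemma tsum_cubic_eq :
    ∑' k : ℕ, (4 * h (k + 1) ^ 3 + 2 * h3 (k + 1)) / 3 / ((k : ℝ) + 1) ^ 2
      = ∑' j : ℕ, 8 / (2 * (j : ℝ) + 1) ^ 5 := by
  have t1 := tendsto_tsum_div_of_le_majorant abs_coeffThree_le tendsto_coeffThree
  have t2 := tendsto_tsum_odd (C := 30)
    (r := fun a β => 2 * (4 * a ^ 3 + 6 * a ^ 2 * β + 4 * a * β ^ 2 + β ^ 3)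
      / (a ^ 4 * (a + β) ^ 4)) (fun a β ha hβ hβ1 => by
        have ha0 : 0 < a := by linarith
        rw [abs_of_nonneg (by positivity), mul_one_div, div_le_div_iff₀ (by positivity)
          (by positivity)]
        have e1 : a ^ 2 * β ≤ a ^ 2 * a := by gcongr; linarith
        have e2 : a * β ^ 2 ≤ a * a ^ 2 := by gcongr; linarith
        have e3 : β ^ 3 ≤ a ^ 3 := by gcongr; linarith
        calc _ ≤ 30 * a ^ 3 * a ^ 2 :=
            mul_le_mul_of_nonneg_right (by linarith) (by positivity)
          _ ≤ 30 * (a ^ 4 * (a + β) ^ 4) := by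
            have : a ^ 5 ≤ a ^ 4 * (a + β) ^ 4 := by
              calc a ^ 5 = a ^ 4 * a := by ring
                _ ≤ a ^ 4 * (a + β) ^ 4 := by
                  gcongr
                  exact (by linarith : a ≤ a + β).trans
                    (le_self_pow₀ (by linarith) (by norm_num))
            linarith)
    (fun a ha => ContinuousAt.div (by fun_prop) (by fun_prop) (by positivity))
  have heq : (fun β : ℝ => ∑' k : ℕ, coeffThree β (k + 1) / (((k : ℝ) + 1) * ((k : ℝ) + 1 + β)))
      =ᶠ[𝓝[>] 0] fun β => ∑' j : ℕ, 2 * (4 * (2 * (j : ℝ) + 1) ^ 3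
        + 6 * (2 * (j : ℝ) + 1) ^ 2 * β + 4 * (2 * (j : ℝ) + 1) * β ^ 2 + β ^ 3)
        / ((2 * (j : ℝ) + 1) ^ 4 * (2 * (j : ℝ) + 1 + β) ^ 4) := by
    filter_upwards [eventually_mem_unit] with β hβ
    have hβ0 := hβ.1
    rw [kernelSum_div hβ.1, ← ((kernelSum_coeffThree_hasSum hβ.1.le hβ.2).div_const β).tsum_eq]
    refine tsum_congr fun j => ?_
    field_simp
    ring
  rw [tendsto_nhds_unique (t1.congr' heq) t2]
  refine tsum_congr fun j => ?_
  field_simp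
  ring

lemma hasSum_coeffTwo_div {β : ℝ} (hβ : 0 < β) (hβ1 : β ≤ 1) :
    HasSum (fun j : ℕ => 2 * (3 * (2 * (j : ℝ) + 1) ^ 2 + 3 * (2 * (j : ℝ) + 1) * β + β ^ 2)
        / ((2 * (j : ℝ) + 1) ^ 3 * (2 * (j : ℝ) + 1 + β) ^ 3))
      (∑' k : ℕ, coeffTwo β (k + 1) / (((k : ℝ) + 1) * ((k : ℝ) + 1 + β))) := by
  rw [kernelSum_div hβ]
  refine ((kernelSum_coeffTwo_hasSum hβ.le hβ1).div_const β).congr_fun fun j => ?_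
  field_simp
  ring

lemma tsum_sq_eq :
    ∑' k : ℕ, 2 * h (k + 1) ^ 2 / ((k : ℝ) + 1) ^ 2 = ∑' j : ℕ, 6 / (2 * (j : ℝ) + 1) ^ 4 := by
  have t1 := tendsto_tsum_div_of_le_majorant abs_coeffTwo_le tendsto_coeffTwo
  have t2 := tendsto_tsum_odd (C := 14)
    (r := fun a β => 2 * (3 * a ^ 2 + 3 * a * β + β ^ 2) / (a ^ 3 * (a + β) ^ 3))
    (fun a β ha hβ hβ1 => by
        have ha0 : 0 < a := by linarith
        rw [abs_of_nonneg (by positivity), mul_one_div, div_le_div_iff₀ (by positivity)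
          (by positivity)]
        have e1 : a * β ≤ a * a := by gcongr; linarith
        have e2 : β ^ 2 ≤ a ^ 2 := by gcongr; linarith
        calc _ ≤ 14 * a ^ 2 * a ^ 2 :=
            mul_le_mul_of_nonneg_right (by linarith) (by positivity)
          _ ≤ 14 * (a ^ 3 * (a + β) ^ 3) := by
            have : a ^ 4 ≤ a ^ 3 * (a + β) ^ 3 := by
              calc a ^ 4 = a ^ 3 * a := by ring
                _ ≤ a ^ 3 * (a + β) ^ 3 := by
                  gcongr
                  exact (by linarith : a ≤ a + β).trans
                    (le_self_pow₀ (by linarith) (by norm_num))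
            linarith)
    (fun a ha => ContinuousAt.div (by fun_prop) (by fun_prop) (by positivity))
  have heq := eventually_mem_unit.mono fun β hβ => (hasSum_coeffTwo_div hβ.1 hβ.2).tsum_eq.symm
  rw [tendsto_nhds_unique (t1.congr' heq) t2]
  refine tsum_congr fun j => ?_
  field_simp
  ring

/-- The difference quotient `(h k - oddSum 1 β k) / β`. -/
noncomputable def oddSlope (β : ℝ) (k : ℕ) : ℝ :=
  ∑ j ∈ Finset.range k, 1 / ((2 * (j : ℝ) + 1) * (2 * (j : ℝ) + 1 + β))

lemma mul_oddSlope {β : ℝ} (hβ : 0 ≤ β) (k : ℕ) : β * oddSlope β k = h k - oddSum 1 β k := by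
  rw [oddSlope, h, oddSum, ← Finset.sum_sub_distrib, Finset.mul_sum]
  refine Finset.sum_congr rfl fun j _ => ?_
  field_simp
  ring

lemma oddSlope_nonneg {β : ℝ} (hβ : 0 ≤ β) (k : ℕ) : 0 ≤ oddSlope β k :=
  Finset.sum_nonneg fun j _ => by positivity

lemma oddSlope_le {β : ℝ} (hβ : 0 ≤ β) (k : ℕ) : oddSlope β k ≤ h k := by
  refine Finset.sum_le_sum fun j _ => one_div_le_one_div_of_le (by positivity) ?_
  have hj : (0 : ℝ) ≤ j := j.cast_nonneg
  exact le_mul_of_one_le_right (by positivity) (by linarith)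

lemma tendsto_oddSlope (k : ℕ) : Tendsto (fun β => oddSlope β k) (𝓝[>] 0) (𝓝 (h2 k)) := by
  refine Tendsto.mono_left ?_ nhdsWithin_le_nhds
  refine tendsto_finsetSum _ fun j _ => ?_
  have : ContinuousAt (fun β : ℝ => 1 / ((2 * (j : ℝ) + 1) * (2 * (j : ℝ) + 1 + β))) 0 :=
    continuousAt_const.div (by fun_prop) (by positivity)
  simpa [ContinuousAt, sq] using this

/-- The coefficient in the difference quotient of `∑ coeffTwo β k / (k (k + β))` at `β = 0`. -/
noncomputable def slopeCoeff (β : ℝ) (k : ℕ) : ℝ :=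
  2 * h k ^ 2 / k + 2 * (h k + oddSum 1 β k) * oddSlope β k

lemma abs_slopeCoeff_le (β : ℝ) (hβ : 0 ≤ β) (k : ℕ) : |slopeCoeff β k| ≤ 4 * majorant k := by
  have h0 := h_nonneg k
  have h1 := oddSum_nonneg 1 hβ k
  have h2 := oddSum_le_h le_rfl hβ k
  have h3 := oddSlope_nonneg hβ k
  have h4 := oddSlope_le hβ k
  have h5 := cubic_le_majorant h0 le_rfl
  have h6 : 2 * h k ^ 2 / k ≤ 2 * h k ^ 2 := by
    rcases k.eq_zero_or_pos with rfl | hk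
    · simp [h]
    · exact div_le_self (by positivity) (by exact_mod_cast hk)
  have h7 : 2 * (h k + oddSum 1 β k) * oddSlope β k ≤ 2 * (h k + h k) * h k := by gcongr
  rw [slopeCoeff, abs_of_nonneg (by positivity)]
  nlinarith [pow_nonneg h0 2, pow_nonneg h0 3]

lemma tendsto_slopeCoeff (k : ℕ) : Tendsto (fun β => slopeCoeff β k) (𝓝[>] 0)
    (𝓝 (2 * h k ^ 2 / k + 4 * (h k * h2 k))) := by
  have h1 := tendsto_oddSum 1 k
  rw [oddSum_one_zero] at h1
  have := (((h1.const_add (h k)).const_mul 2).mul (tendsto_oddSlope k)).const_add (2 * h k ^ 2 / k)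
  rwa [show 2 * h k ^ 2 / k + 4 * (h k * h2 k) = 2 * h k ^ 2 / k + 2 * (h k + h k) * h2 k by ring]

lemma tsum_quadratic_eq :
    ∑' k : ℕ, (2 * h (k + 1) ^ 2 / ((k + 1 : ℕ) : ℝ) + 4 * (h (k + 1) * h2 (k + 1)))
        / ((k : ℝ) + 1) ^ 2
      = ∑' j : ℕ, 12 / (2 * (j : ℝ) + 1) ^ 5 := by
  have t1 := tendsto_tsum_div_of_le_majorant abs_slopeCoeff_le tendsto_slopeCoeff
  have t2 := tendsto_tsum_odd (C := 34)
    (r := fun a β => 2 * (6 * a ^ 2 + 8 * a * β + 3 * β ^ 2) / (a ^ 4 * (a + β) ^ 3))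
    (fun a β ha hβ hβ1 => by
        have ha0 : 0 < a := by linarith
        rw [abs_of_nonneg (by positivity), mul_one_div, div_le_div_iff₀ (by positivity)
          (by positivity)]
        have e1 : a * β ≤ a * a := by gcongr; linarith
        have e2 : β ^ 2 ≤ a ^ 2 := by gcongr; linarith
        calc _ ≤ 34 * a ^ 2 * a ^ 2 :=
            mul_le_mul_of_nonneg_right (by linarith) (by positivity)
          _ ≤ 34 * (a ^ 4 * (a + β) ^ 3) := by
            have : a ^ 4 ≤ a ^ 4 * (a + β) ^ 3 :=
              le_mul_of_one_le_right (by positivity) (one_le_pow₀ (by linarith))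
            linarith)
    (fun a ha => ContinuousAt.div (by fun_prop) (by fun_prop) (by positivity))
  have heq : (fun β : ℝ => ∑' k : ℕ, slopeCoeff β (k + 1) / (((k : ℝ) + 1) * ((k : ℝ) + 1 + β)))
      =ᶠ[𝓝[>] 0] fun β => ∑' j : ℕ, 2 * (6 * (2 * (j : ℝ) + 1) ^ 2 + 8 * (2 * (j : ℝ) + 1) * β
        + 3 * β ^ 2) / ((2 * (j : ℝ) + 1) ^ 4 * (2 * (j : ℝ) + 1 + β) ^ 3) := by
    filter_upwards [eventually_mem_unit] with β hβ
    obtain ⟨hβ0, hβ1⟩ := hβ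
    have hr := hasSum_coeffTwo_div hβ0 hβ1
    have hl := (summable_div_of_le_majorant (abs_coeffTwo_le β hβ0.le) hβ0.le).hasSum
    have hl0 := (summable_div_of_le_majorant (abs_coeffTwo_le 0 le_rfl) le_rfl).hasSum
    have hr0 : HasSum (fun j : ℕ => 6 / (2 * (j : ℝ) + 1) ^ 4)
        (∑' k : ℕ, coeffTwo 0 (k + 1) / (((k : ℝ) + 1) * ((k : ℝ) + 1 + 0))) := by
      have hs : Summable fun j : ℕ => 6 / (2 * (j : ℝ) + 1) ^ 4 := by
        refine Summable.of_nonneg_of_le (fun j => by positivity) (fun j => ?_)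
          (summable_odd_sq.mul_left 6)
        rw [mul_one_div]
        refine div_le_div_of_nonneg_left (by norm_num) (by positivity)
          (pow_le_pow_right₀ ?_ (by norm_num))
        linarith [(Nat.cast_nonneg j : (0 : ℝ) ≤ j)]
      have e := hs.hasSum
      rw [← tsum_sq_eq] at e
      convert e using 4 with k
      · rw [coeffTwo, oddSum_one_zero]
      · ring
    have e1 := ((hl0.sub hl).div_const β).tsum_eq
    have e2 := ((hr0.sub hr).div_const β).tsum_eq
    rw [← e2] at e1
    refine Eq.trans (tsum_congr fun k => ?_) (e1.trans (tsum_congr fun j => ?_))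
    · have hg := mul_oddSlope hβ0.le (k + 1)
      rw [slopeCoeff, coeffTwo, coeffTwo, oddSum_one_zero,
        show oddSum 1 β (k + 1) = h (k + 1) - β * oddSlope β (k + 1) by linarith]
      push_cast
      field_simp
      ring
    · field_simp
      ring
  rw [tendsto_nhds_unique (t1.congr' heq) t2]
  refine tsum_congr fun j => ?_
  field_simp
  ring

lemma h_add (n k : ℕ) : h (n + k) = h n + oddSum 1 (2 * n) k := by
  rw [h, h, oddSum, Finset.sum_range_add]
  congr 1
  refine Finset.sum_congr rfl fun j _ => ?_
  push_cast
  ring_nf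

lemma hasSum_kernel_mul_h_sq (n : ℕ) :
    HasSum (fun k : ℕ => kernel (2 * n) k * h (n + (k + 1)) ^ 2)
      (h n ^ 2 * (h n + H n / 2) + 2 * h n * h2 n + h3 n) := by
  have hn : (0 : ℝ) ≤ 2 * n := by positivity
  have s0 := (summable_kernel_mul abs_one_le_majorant hn).hasSum
  have s1 := (summable_kernel_mul (abs_coeffOne_le _ hn) hn).hasSum
  have s2 := (summable_kernel_mul (abs_coeffTwo_le _ hn) hn).hasSum
  have e0 := kernelSum_one_even n
  have e1 := kernelSum_coeffOne_even n
  have e2 := kernelSum_coeffTwo_even n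
  rw [kernelSum] at e0 e1 e2
  rw [e0] at s0
  rw [e1] at s1
  rw [e2] at s2
  have := ((s0.mul_left (h n ^ 2)).add (s1.mul_left (h n))).add (s2.mul_left (1 / 2))
  rw [show h n ^ 2 * (h n + H n / 2) + 2 * h n * h2 n + h3 n
    = h n ^ 2 * (h n + H n / 2) + h n * (2 * h2 n) + 1 / 2 * (2 * h3 n) by ring]
  refine this.congr_fun fun k => ?_
  rw [h_add, coeffOne, coeffTwo]
  ring

lemma sum_inv_add (n : ℕ) :
    ∑ i ∈ Finset.range n, 1 / ((n : ℝ) + (i + 1)) = h n - H n / 2 := by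
  induction n with
  | zero => simp [h, H]
  | succ n ih =>
    have e1 := Finset.sum_range_succ (fun i : ℕ => 1 / ((n : ℝ) + (i + 1))) n
    have e2 := Finset.sum_range_succ' (fun i : ℕ => 1 / ((n : ℝ) + (i + 1))) n
    have e3 : ∑ i ∈ Finset.range n, 1 / (((n + 1 : ℕ) : ℝ) + (i + 1))
        = ∑ i ∈ Finset.range n, 1 / ((n : ℝ) + ((i + 1 : ℕ) + 1)) :=
      Finset.sum_congr rfl fun i _ => by
        push_cast
        ring_nf
    have e4 : h (n + 1) = h n + 1 / (2 * (n : ℝ) + 1) := Finset.sum_range_succ _ _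
    have e5 : H (n + 1) = H n + 1 / ((n : ℝ) + 1) := Finset.sum_range_succ _ _
    rw [Finset.sum_range_succ, e3, e4, e5]
    have e6 : ∑ i ∈ Finset.range n, 1 / ((n : ℝ) + ((i + 1 : ℕ) + 1))
        = h n - H n / 2 + 1 / ((n : ℝ) + (n + 1)) - 1 / ((n : ℝ) + ((0 : ℕ) + 1)) := by linarith
    rw [e6]
    push_cast
    field_simp
    ring

/-- The partial fraction evaluation of `∑_{n<m} 2 / (n (m² - n²))`, `m = s + 2`. -/
lemma sum_antidiagonal_kernel (s : ℕ) :
    ∑ p ∈ Finset.HasAntidiagonal.antidiagonal s, 1 / ((p.1 : ℝ) + 1) ^ 2 * kernel (2 * (p.1 + 1 : ℕ)) p.2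
      = (7 / 2 * H (s + 2) - h (s + 2) - 5 / (2 * ((s : ℝ) + 2))) / ((s : ℝ) + 2) ^ 2 := by
  have hterm : ∀ p ∈ Finset.HasAntidiagonal.antidiagonal s,
      1 / ((p.1 : ℝ) + 1) ^ 2 * kernel (2 * (p.1 + 1 : ℕ)) p.2
        = (2 * (1 / ((p.1 : ℝ) + 1)) + 1 / ((p.2 : ℝ) + 1)
          - 1 / (((s + 2 : ℕ) : ℝ) + (p.1 + 1))) / ((s : ℝ) + 2) ^ 2 := by
    rintro ⟨n, k⟩ hp
    obtain rfl : n + k = s := by simpa using hp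
    rw [kernel_eq (by positivity)]
    push_cast
    have : (n : ℝ) + k + 2 + (n + 1) = k + 1 + 2 * (n + 1) := by ring
    rw [this]
    field_simp
    ring
  rw [Finset.sum_congr rfl hterm, ← Finset.sum_div, Finset.sum_sub_distrib,
    Finset.sum_add_distrib, ← Finset.mul_sum]
  have e1 : ∑ p ∈ Finset.HasAntidiagonal.antidiagonal s, 1 / ((p.1 : ℝ) + 1) = H (s + 1) := by
    rw [Finset.Nat.sum_antidiagonal_eq_sum_range_succ_mk, H]
  have e2 : ∑ p ∈ Finset.HasAntidiagonal.antidiagonal s, 1 / ((p.2 : ℝ) + 1) = H (s + 1) := by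
    rw [← e1, ← Finset.Nat.sum_antidiagonal_swap]
    rfl
  have e3 : ∑ p ∈ Finset.HasAntidiagonal.antidiagonal s, 1 / (((s + 2 : ℕ) : ℝ) + (p.1 + 1))
      = h (s + 2) - H (s + 2) / 2 - 1 / (2 * ((s : ℝ) + 2)) := by
    rw [Finset.Nat.sum_antidiagonal_eq_sum_range_succ_mk, ← sum_inv_add,
      Finset.sum_range_succ _ (s + 1)]
    push_cast
    rw [show (s : ℝ) + 2 + (s + 1 + 1) = 2 * (s + 2) by ring]
    simp
  have e4 : H (s + 2) = H (s + 1) + 1 / ((s : ℝ) + 2) := by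
    rw [H, Finset.sum_range_succ, H]
    push_cast
    ring_nf
  rw [e1, e2, e3, e4]
  congr 1
  field_simp
  ring

lemma summable_sq_of_le {q : ℕ → ℝ} {C : ℝ} (hq : ∀ k, |q k| ≤ C * majorant k) :
    Summable fun k : ℕ => q (k + 1) / ((k : ℝ) + 1) ^ 2 := by
  simpa [sq] using summable_div_of_le_majorant hq le_rfl

lemma h2_le_h (k : ℕ) : h2 k ≤ h k := by
  rw [← oddSum_two_zero]
  exact oddSum_le_h (by norm_num) le_rfl k

lemma h3_le_h (k : ℕ) : h3 k ≤ h k := by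
  rw [← oddSum_three_zero]
  exact oddSum_le_h (by norm_num) le_rfl k

lemma summable_H_mul_sq : Summable fun k : ℕ => H (k + 1) * h (k + 1) ^ 2 / ((k : ℝ) + 1) ^ 2 := by
  refine summable_sq_of_le (q := fun k => H k * h k ^ 2) (C := 2) fun k => ?_
  have h0 := h_nonneg k
  have := mul_le_mul_of_nonneg_right (H_le_two_h k) (sq_nonneg (h k))
  have := cubic_le_majorant h0 le_rfl
  rw [abs_of_nonneg (mul_nonneg (H_nonneg k) (by positivity))]
  nlinarith [pow_nonneg h0 2, pow_nonneg h0 3]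

lemma summable_h_mul_h2 : Summable fun k : ℕ => h (k + 1) * h2 (k + 1) / ((k : ℝ) + 1) ^ 2 := by
  refine summable_sq_of_le (q := fun k => h k * h2 k) (C := 1) fun k => ?_
  have h0 := h_nonneg k
  have := mul_le_mul_of_nonneg_left (h2_le_h k) h0
  have := cubic_le_majorant h0 le_rfl
  rw [abs_of_nonneg (mul_nonneg h0 (h2_nonneg k))]
  nlinarith [pow_nonneg h0 2, pow_nonneg h0 3]

lemma summable_h_cube : Summable fun k : ℕ => h (k + 1) ^ 3 / ((k : ℝ) + 1) ^ 2 := by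
  refine summable_sq_of_le (q := fun k => h k ^ 3) (C := 1) fun k => ?_
  have h0 := h_nonneg k
  have := cubic_le_majorant h0 le_rfl
  rw [abs_of_nonneg (by positivity)]
  nlinarith [pow_nonneg h0 2]

lemma summable_h3 : Summable fun k : ℕ => h3 (k + 1) / ((k : ℝ) + 1) ^ 2 := by
  refine summable_sq_of_le (q := h3) (C := 1) fun k => ?_
  have h0 := h_nonneg k
  have := h3_le_h k
  have := cubic_le_majorant h0 le_rfl
  rw [abs_of_nonneg (h3_nonneg k)]
  nlinarith [pow_nonneg h0 2, pow_nonneg h0 3]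

lemma summable_h_sq_div_cube : Summable fun k : ℕ => h (k + 1) ^ 2 / ((k : ℝ) + 1) ^ 3 := by
  have hs : Summable fun k : ℕ => h (k + 1) ^ 2 / ((k : ℝ) + 1) ^ 2 := by
    refine summable_sq_of_le (q := fun k => h k ^ 2) (C := 1) fun k => ?_
    have h0 := h_nonneg k
    have := cubic_le_majorant h0 le_rfl
    rw [abs_of_nonneg (by positivity)]
    nlinarith [pow_nonneg h0 3]
  refine Summable.of_nonneg_of_le (fun k => by positivity) (fun k => ?_) hs
  refine div_le_div_of_nonneg_left (by positivity) (by positivity)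
    (pow_le_pow_right₀ ?_ (by norm_num))
  linarith [(Nat.cast_nonneg k : (0 : ℝ) ≤ k)]

/-- The series identity obtained by summing `(1/n²) (1/k - 1/(k+2n)) h_{n+k}²` in two orders. -/
lemma hasSum_exchange {T : ℝ}
    (hT : HasSum (fun n : ℕ => (h (n + 1) ^ 2 * (h (n + 1) + H (n + 1) / 2)
      + 2 * h (n + 1) * h2 (n + 1) + h3 (n + 1)) / ((n : ℝ) + 1) ^ 2) T) :
    HasSum (fun k : ℕ => h (k + 1) ^ 2 * (7 / 2 * H (k + 1) - h (k + 1) - 5 / (2 * ((k : ℝ) + 1)))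
      / ((k : ℝ) + 1) ^ 2) T := by
  set a : ℕ × ℕ → ℝ := fun p => 1 / ((p.1 : ℝ) + 1) ^ 2 * kernel (2 * (p.1 + 1 : ℕ)) p.2
    * h (p.1 + 1 + (p.2 + 1)) ^ 2 with ha
  have ha0 : 0 ≤ a := fun p =>
    mul_nonneg (mul_nonneg (by positivity) (kernel_nonneg (by positivity) _)) (by positivity)
  have hrow : ∀ n : ℕ, HasSum (fun k => a (n, k)) ((h (n + 1) ^ 2 * (h (n + 1) + H (n + 1) / 2)
      + 2 * h (n + 1) * h2 (n + 1) + h3 (n + 1)) / ((n : ℝ) + 1) ^ 2) := by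
    intro n
    rw [div_eq_inv_mul]
    refine ((hasSum_kernel_mul_h_sq (n + 1)).mul_left (((n : ℝ) + 1) ^ 2)⁻¹).congr_fun fun k => ?_
    simp only [ha]
    ring
  have hsum : Summable a := by
    refine (summable_prod_of_nonneg ha0).2 ⟨fun n => (hrow n).summable, ?_⟩
    simp only [fun n => (hrow n).tsum_eq]
    exact hT.summable
  have hasum : HasSum a T := by
    rw [← (hsum.hasSum.prod_fiberwise hrow).unique hT]
    exact hsum.hasSum
  have hdiag := (Finset.HasAntidiagonal.sigmaAntidiagonalEquivProd.hasSum_iff.2 hasum).sigma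
    fun s => hasSum_fintype _
  have hs : ∀ s : ℕ, ∑ p : Finset.HasAntidiagonal.antidiagonal s,
      (a ∘ Finset.HasAntidiagonal.sigmaAntidiagonalEquivProd) ⟨s, p⟩
      = h (s + 1 + 1) ^ 2 * (7 / 2 * H (s + 1 + 1) - h (s + 1 + 1)
        - 5 / (2 * (((s + 1 : ℕ) : ℝ) + 1))) / (((s + 1 : ℕ) : ℝ) + 1) ^ 2 := by
    intro s
    have e : ∑ p : Finset.HasAntidiagonal.antidiagonal s, (a ∘ Finset.HasAntidiagonal.sigmaAntidiagonalEquivProd) ⟨s, p⟩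
        = ∑ p ∈ Finset.HasAntidiagonal.antidiagonal s, a p := Finset.sum_coe_sort _ a
    rw [e]
    have e2 : ∀ p ∈ Finset.HasAntidiagonal.antidiagonal s,
        a p = 1 / ((p.1 : ℝ) + 1) ^ 2 * kernel (2 * (p.1 + 1 : ℕ)) p.2 * h (s + 2) ^ 2 := by
      intro p hp
      have : p.1 + 1 + (p.2 + 1) = s + 2 := by
        rw [Finset.HasAntidiagonal.mem_antidiagonal] at hp
        omega
      simp only [ha, this]
    rw [Finset.sum_congr rfl e2, ← Finset.sum_mul, sum_antidiagonal_kernel]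
    push_cast
    rw [show (s : ℝ) + 1 + 1 = s + 2 by ring]
    ring
  simp only [hs] at hdiag
  rw [← hasSum_nat_add_iff' 1]
  rw [sub_eq_self.2]
  · exact hdiag
  · norm_num [h, H]

theorem stmt7 :
    Summable (fun k : ℕ => H (k + 1) * (h (k + 1)) ^ 2 / ((k : ℝ) + 1) ^ 2) ∧
    Summable (fun k : ℕ => (h (k + 1)) ^ 2 / ((k : ℝ) + 1) ^ 3) ∧
    Summable (fun k : ℕ => h (k + 1) * h2 (k + 1) / ((k : ℝ) + 1) ^ 2) ∧
    (∑' k : ℕ, H (k + 1) * (h (k + 1)) ^ 2 / ((k : ℝ) + 1) ^ 2)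
      = (3 / 2) * (∑' k : ℕ, (h (k + 1)) ^ 2 / ((k : ℝ) + 1) ^ 3)
        + 2 * (∑' k : ℕ, h (k + 1) * h2 (k + 1) / ((k : ℝ) + 1) ^ 2) := by
  refine ⟨summable_H_mul_sq, summable_h_sq_div_cube, summable_h_mul_h2, ?_⟩
  have hA := summable_H_mul_sq.hasSum
  have hB := summable_h_sq_div_cube.hasSum
  have hC := summable_h_mul_h2.hasSum
  have hF := summable_h_cube.hasSum
  have hO := summable_h3.hasSum
  set A := ∑' k : ℕ, H (k + 1) * h (k + 1) ^ 2 / ((k : ℝ) + 1) ^ 2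
  set B := ∑' k : ℕ, h (k + 1) ^ 2 / ((k : ℝ) + 1) ^ 3
  set C := ∑' k : ℕ, h (k + 1) * h2 (k + 1) / ((k : ℝ) + 1) ^ 2
  set F := ∑' k : ℕ, h (k + 1) ^ 3 / ((k : ℝ) + 1) ^ 2
  set O := ∑' k : ℕ, h3 (k + 1) / ((k : ℝ) + 1) ^ 2
  have hcubic : (4 * F + 2 * O) / 3 = ∑' j : ℕ, 8 * (1 / (2 * (j : ℝ) + 1) ^ 5) := by
    simp only [mul_one_div]
    rw [← tsum_cubic_eq, ← (((hF.mul_left 4).add (hO.mul_left 2)).div_const 3).tsum_eq]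
    exact tsum_congr fun k => by ring
  have hquadratic : 2 * B + 4 * C = ∑' j : ℕ, 12 * (1 / (2 * (j : ℝ) + 1) ^ 5) := by
    simp only [mul_one_div]
    rw [← tsum_quadratic_eq, ← ((hB.mul_left 2).add (hC.mul_left 4)).tsum_eq]
    refine tsum_congr fun k => ?_
    push_cast
    field_simp
  have hexchange : 7 / 2 * A - F - 5 / 2 * B = F + A / 2 + 2 * C + O := by
    have hT := ((hF.add (hA.div_const 2)).add (hC.mul_left 2)).add hO
    have hE := ((hA.mul_left (7 / 2)).sub hF).sub (hB.mul_left (5 / 2))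
    refine hE.unique ((hasSum_exchange (hT.congr_fun fun n => ?_)).congr_fun fun k => ?_)
    · ring
    · field_simp
  rw [tsum_mul_left] at hcubic hquadratic
  linarith
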